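/- Let M ⊂ ℝ^m be the mean-value parameter space of an m-dimensional exponential family, with M a product of open intervals, and let M' be a CINECSI subset of M. Then there exist positive constants c₁, c₂, c₃ such that for all μ, μ' ∈ M': c₁‖μ'−μ‖₂² ≤ c₂·d_ST(μ'‖μ) ≤ d_{H²}(μ',μ) ≤ d_R(μ',μ) ≤ D(μ'‖μ) ≤ c₃‖μ'−μ‖₂². -/

import Mathlib

open MeasureTheory ProbabilityTheory Real Set
open scoped ENNReal BigOperators

noncomputable section

namespace SwitchPaper

variable {𝒳 : Type*} [MeasurableSpace 𝒳]

/-- Squared Euclidean distance `‖a − b‖₂²`. -/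
def sqDist {m : ℕ} (a b : Fin m → ℝ) : ℝ := ∑ j, (a j - b j) ^ 2

/-- Euclidean inner product. -/
def dot {m : ℕ} (a b : Fin m → ℝ) : ℝ := ∑ j, a j * b j

/-- A CINECSI subset of `M`: a Connected subset of the interior of `M` that is itself
Compact and has NonEmpty interior. -/
def CINECSI {m : ℕ} (M' M : Set (Fin m → ℝ)) : Prop :=
  IsConnected M' ∧ M' ⊆ interior M ∧ IsCompact M' ∧ (interior M').Nonempty

/-- Hellinger affinity `∫ √(p q) dν = E_{p}[√(q/p)]` between two densities w.r.t. `ν`. -/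
def hellingerAffinity (ν : Measure 𝒳) (p q : 𝒳 → ℝ) : ℝ := ∫ x, Real.sqrt (p x * q x) ∂ν

/-- Squared Hellinger distance `d_{H²}(p,q) = 2(1 − E_p[√(q/p)])`. -/
def dH2 (ν : Measure 𝒳) (p q : 𝒳 → ℝ) : ℝ := 2 * (1 - hellingerAffinity ν p q)

/-- Rényi divergence of order 1/2, `d_R(p,q) = −2 log E_p[√(q/p)]`; it is symmetric. -/
def dRenyiHalf (ν : Measure 𝒳) (p q : 𝒳 → ℝ) : ℝ := -2 * Real.log (hellingerAffinity ν p q)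

/-- Kullback–Leibler divergence `D(p‖q) = ∫ p log(p/q) dν` between densities w.r.t. `ν`. -/
def klDiv' (ν : Measure 𝒳) (p q : 𝒳 → ℝ) : ℝ := ∫ x, p x * Real.log (p x / q x) ∂ν

/-- `p : M → 𝒳 → ℝ` is an `m`-dimensional exponential family w.r.t. the base measure `ν`,
given in its mean-value parameterization: the densities have the exponential form
`p_μ(x) = exp(θ(μ)ᵀ φ(x) − ψ(θ(μ))) r(x)`, each `p_μ` is a probability density w.r.t. `ν`,
the mean of the sufficient statistic `φ` under `p_μ` is `μ`, the parameter set `M` is an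
open connected product of open intervals, and the representation is minimal (the components
of `φ`, together with constants, are affinely independent). -/
structure IsMeanValueExpFam {m : ℕ} (ν : Measure 𝒳) (M : Set (Fin m → ℝ))
    (p : (Fin m → ℝ) → 𝒳 → ℝ) (θ : (Fin m → ℝ) → (Fin m → ℝ))
    (φ : 𝒳 → (Fin m → ℝ)) (ψ : (Fin m → ℝ) → ℝ) (carrier : 𝒳 → ℝ) : Prop where
  carrier_pos : ∀ x, 0 < carrier x
  φ_meas : Measurable φ
  p_meas : ∀ μ, Measurable (p μ)
  M_conn : IsConnected M
  M_prod : ∃ S : Fin m → Set ℝ, (∀ j, IsOpen (S j) ∧ (S j).OrdConnected) ∧ M = Set.univ.pi S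
  p_form : ∀ μ ∈ M, ∀ x, p μ x = Real.exp (dot (θ μ) (φ x) - ψ (θ μ)) * carrier x
  p_prob : ∀ μ ∈ M, ∫ x, p μ x ∂ν = 1
  φ_int : ∀ μ ∈ M, Integrable (fun x => (∑ j, |φ x j|) * p μ x) ν
  mean_eq : ∀ μ ∈ M, ∀ i, ∫ x, φ x i * p μ x ∂ν = μ i
  minimal : ∀ c : Fin m → ℝ, ∀ d : ℝ, (∀ x, dot c (φ x) = d) → c = 0

/-- Covariance matrix of the sufficient statistic `φ` under `p_μ`. -/
def covMatrix {m : ℕ} (ν : Measure 𝒳) (p : (Fin m → ℝ) → 𝒳 → ℝ) (φ : 𝒳 → (Fin m → ℝ))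
    (μ : Fin m → ℝ) : Matrix (Fin m) (Fin m) ℝ :=
  Matrix.of fun i j => ∫ x, (φ x i - μ i) * (φ x j - μ j) * p μ x ∂ν

/-- Fisher information matrix in the mean-value parameterization: the inverse of the
covariance matrix of the sufficient statistic. -/
def fisherInfo {m : ℕ} (ν : Measure 𝒳) (p : (Fin m → ℝ) → 𝒳 → ℝ) (φ : 𝒳 → (Fin m → ℝ))
    (μ : Fin m → ℝ) : Matrix (Fin m) (Fin m) ℝ := (covMatrix ν p φ μ)⁻¹

/-- Quadratic form `vᵀ J v`. -/
def quadForm {m : ℕ} (J : Matrix (Fin m) (Fin m) ℝ) (v : Fin m → ℝ) : ℝ :=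
  ∑ i, ∑ j, v i * J i j * v j

/-- Standardized squared error (squared Mahalanobis distance)
`d_ST(a ‖ b) = (b − a)ᵀ I(a) (b − a)`, with `I` the Fisher information. -/
def dST {m : ℕ} (ν : Measure 𝒳) (p : (Fin m → ℝ) → 𝒳 → ℝ) (φ : 𝒳 → (Fin m → ℝ))
    (a b : Fin m → ℝ) : ℝ := quadForm (fisherInfo ν p φ a) (b - a)

/-- Joint density (likelihood) of an i.i.d. sample. -/
def likelihood {m : ℕ} (p : (Fin m → ℝ) → 𝒳 → ℝ) (μ : Fin m → ℝ) {n : ℕ}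
    (xs : Fin n → 𝒳) : ℝ := ∏ i, p μ (xs i)

/-- The law of `n` i.i.d. observations, each with density `f` w.r.t. `ν`. -/
def iidLaw (ν : Measure 𝒳) (f : 𝒳 → ℝ) (n : ℕ) : Measure (Fin n → 𝒳) :=
  (Measure.pi fun _ : Fin n => ν).withDensity fun xs => ENNReal.ofReal (∏ i, f (xs i))

/-- The (raw) maximum likelihood estimator of an exponential family in its mean-value
parameterization: the empirical mean of the sufficient statistic. -/
def mleRaw {m : ℕ} (φ : 𝒳 → (Fin m → ℝ)) {n : ℕ} (xs : Fin n → 𝒳) : Fin m → ℝ :=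
  fun j => (∑ i, φ (xs i) j) / n

/-- Projection `Π₀` onto the simple model: keep the first `m₀` coordinates, replace the
remaining ones by the fixed values. -/
def proj0 {m₁ : ℕ} (m₀ : ℕ) (fixed : Fin m₁ → ℝ) (μ : Fin m₁ → ℝ) : Fin m₁ → ℝ :=
  fun j => if (j : ℕ) < m₀ then μ j else fixed j

/-- The parameter set of the nested submodel `𝓜₀`: the last `m₁ − m₀` coordinates are
fixed to known values. -/
def nestedSub {m₁ : ℕ} (m₀ : ℕ) (M₁ : Set (Fin m₁ → ℝ)) (fixed : Fin m₁ → ℝ) :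
    Set (Fin m₁ → ℝ) := {μ ∈ M₁ | ∀ j : Fin m₁, m₀ ≤ (j : ℕ) → μ j = fixed j}

/-- Embedding of the `m₀`-dimensional parameter of the simple model into `ℝ^{m₁}`. -/
def embed0 {m₀ m₁ : ℕ} (h : m₀ ≤ m₁) (fixed : Fin m₁ → ℝ) (t : Fin m₀ → ℝ) : Fin m₁ → ℝ :=
  fun j => if hj : (j : ℕ) < m₀ then t ⟨(j : ℕ), hj⟩ else fixed j

/-- Bayes marginal density of a sample: `p_B(xⁿ) = ∫_M w(μ) p_μ(xⁿ) dμ`. -/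
def bayesMarginal {m : ℕ} (p : (Fin m → ℝ) → 𝒳 → ℝ) (M : Set (Fin m → ℝ))
    (w : (Fin m → ℝ) → ℝ) {n : ℕ} (xs : Fin n → 𝒳) : ℝ :=
  ∫ μ in M, w μ * likelihood p μ xs

/-- The first `k` observations of a sample of size `n ≥ k`. -/
def prefixObs {n : ℕ} (xs : Fin n → 𝒳) (k : ℕ) (h : k ≤ n) : Fin k → 𝒳 :=
  fun i => xs (Fin.castLE h i)

/-- The strategy `p̄_t` that switches from the simple to the complex model after `t − 1`
observations: `p̄_t(xⁿ) = p_{B,0}(x^{t−1}) · p_{B,1}(x_t,…,x_n | x^{t−1})`. -/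
def pBar (pB0 pB1 : (k : ℕ) → (Fin k → 𝒳) → ℝ) (t : ℕ) {n : ℕ} (xs : Fin n → 𝒳) : ℝ :=
  if h : t - 1 < n then
    pB0 (t - 1) (prefixObs xs (t - 1) h.le) * pB1 n xs / pB1 (t - 1) (prefixObs xs (t - 1) h.le)
  else pB0 n xs

/-- The switch distribution `p_{sw,1}(xⁿ) = Σ_t π(t) p̄_t(xⁿ)`. -/
def pSwitch (pB0 pB1 : (k : ℕ) → (Fin k → 𝒳) → ℝ) (pri : ℕ → ℝ) {n : ℕ} (xs : Fin n → 𝒳) : ℝ :=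
  ∑' t : ℕ, pri t * pBar pB0 pB1 t xs

/-- A prior on switching times supported on powers of two, with `π(2^i) ∝ i^{−κ}`. -/
def SwitchPrior (pri : ℕ → ℝ) (κ : ℝ) : Prop :=
  (∀ t, 0 ≤ pri t) ∧ (∑' t : ℕ, pri t = 1) ∧ (∀ t, pri t ≠ 0 → ∃ i : ℕ, t = 2 ^ i) ∧ 0 < pri 1 ∧
    ∃ c > 0, ∀ i : ℕ, 1 ≤ i → pri (2 ^ i) = c * (i : ℝ) ^ (-κ)

/-- The event (at sample size `n`) that the switch criterion selects the simple model,
i.e. `p_{sw,1}(xⁿ)/p_{B,0}(xⁿ) ≤ 1`. -/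
def swSelectsSimple (pB0 pB1 : (k : ℕ) → (Fin k → 𝒳) → ℝ) (pri : ℕ → ℝ) (n : ℕ) :
    Set (Fin n → 𝒳) := {xs | pSwitch pB0 pB1 pri xs / pB0 n xs ≤ 1}

/-- `small_b(n)`: equal to `1` for `n < b₁` and to `b₂ e^{−b₃ n}` for `n ≥ b₁`. -/
def smallFn (b₁ b₂ b₃ : ℝ) (n : ℕ) : ℝ :=
  if (n : ℝ) < b₁ then 1 else b₂ * Real.exp (-b₃ * n)

/-- Estimators `μ̆₀, μ̆₁` are sufficiently efficient (with constant `C`, on the set `M₁'`)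
w.r.t. the divergence `dgen`: for all `n` and `μ₁ ∈ M₁'`, the risks
`E_{μ₁}[dgen(μ₀, μ̆₀(Xⁿ))]` and `E_{μ₁}[dgen(μ₁, μ̆₁(Xⁿ))]` are bounded by `C/n`,
where `μ₀ = Π₀(μ₁)`. -/
def SuffEff {m₁ : ℕ} (ν : Measure 𝒳) (p : (Fin m₁ → ℝ) → 𝒳 → ℝ) (m₀ : ℕ)
    (fixed : Fin m₁ → ℝ) (M₁' : Set (Fin m₁ → ℝ))
    (dgen : (Fin m₁ → ℝ) → (Fin m₁ → ℝ) → ℝ)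
    (est0 est1 : (n : ℕ) → (Fin n → 𝒳) → (Fin m₁ → ℝ)) (C : ℝ) : Prop :=
  0 < C ∧ ∀ n : ℕ, 0 < n → ∀ μ₁ ∈ M₁',
    (∫ xs, dgen (proj0 m₀ fixed μ₁) (est0 n xs) ∂(iidLaw ν (p μ₁) n)) ≤ C / n ∧
    (∫ xs, dgen μ₁ (est1 n xs) ∂(iidLaw ν (p μ₁) n)) ≤ C / n

end SwitchPaper


namespace SwitchPaper

section helpers

variable {𝒳 : Type*} [MeasurableSpace 𝒳] {m : ℕ} {ν : Measure 𝒳}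
    {M : Set (Fin m → ℝ)} {p : (Fin m → ℝ) → 𝒳 → ℝ}
    {θ : (Fin m → ℝ) → (Fin m → ℝ)} {φ : 𝒳 → (Fin m → ℝ)} {ψ : (Fin m → ℝ) → ℝ}
    {carrier : 𝒳 → ℝ}

lemma dot_eq (a b : Fin m → ℝ) : dot a b = a ⬝ᵥ b := rfl

lemma dot_sub_left (a b c : Fin m → ℝ) : dot (a - b) c = dot a c - dot b c := by
  simp only [dot_eq, sub_dotProduct]
lemma dot_sub_right (a b c : Fin m → ℝ) : dot a (b - c) = dot a b - dot a c := by
  simp only [dot_eq, dotProduct_sub]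
lemma dot_add_right (a b c : Fin m → ℝ) : dot a (b + c) = dot a b + dot a c := by
  simp only [dot_eq, dotProduct_add]
lemma dot_smul_right (t : ℝ) (a b : Fin m → ℝ) : dot a (t • b) = t * dot a b := by
  simp only [dot_eq, dotProduct_smul, smul_eq_mul]
lemma dot_comm (a b : Fin m → ℝ) : dot a b = dot b a := by
  simp only [dot_eq, dotProduct_comm]
lemma dot_self_nonneg (a : Fin m → ℝ) : 0 ≤ dot a a :=
  Finset.sum_nonneg fun i _ => mul_self_nonneg _
lemma dot_self_eq_zero {a : Fin m → ℝ} (h : dot a a = 0) : a = 0 := by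
  simpa [dot_eq] using h
lemma dot_sq_le (a b : Fin m → ℝ) : dot a b ^ 2 ≤ dot a a * dot b b := by
  have := Finset.sum_mul_sq_le_sq_mul_sq Finset.univ a b
  simpa [dot, sq] using this
lemma abs_dot_le (a b : Fin m → ℝ) : |dot a b| ≤ ‖a‖ * ∑ j, |b j| := by
  unfold dot
  refine (Finset.abs_sum_le_sum_abs _ _).trans ?_
  rw [Finset.mul_sum]
  refine Finset.sum_le_sum fun i _ => ?_
  rw [abs_mul]
  gcongr
  exact norm_le_pi_norm a i
lemma sum_abs_le (a : Fin m → ℝ) : ∑ j, |a j| ≤ m * ‖a‖ := by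
  have := Finset.sum_le_sum (s := Finset.univ) fun i _ => norm_le_pi_norm a i
  simpa using this
lemma dot_self_le (a : Fin m → ℝ) : dot a a ≤ m * ‖a‖ ^ 2 := by
  have := Finset.sum_le_sum (s := Finset.univ) (f := fun i => a i * a i) (g := fun _ => ‖a‖ ^ 2)
    fun i _ => by
      have := norm_le_pi_norm a i
      rw [← abs_mul_abs_self, sq]
      exact mul_self_le_mul_self (abs_nonneg _) this
  simpa [dot] using this
lemma norm_sq_le_dot (a : Fin m → ℝ) : ‖a‖ ^ 2 ≤ dot a a := by
  have h : ‖a‖ ≤ √(dot a a) := by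
    refine (pi_norm_le_iff_of_nonneg (Real.sqrt_nonneg _)).2 fun i => ?_
    refine Real.le_sqrt_of_sq_le ?_
    rw [Real.norm_eq_abs, sq_abs, sq]
    exact Finset.single_le_sum (f := fun i => a i * a i) (fun i _ => mul_self_nonneg _)
      (Finset.mem_univ i)
  calc ‖a‖ ^ 2 ≤ √(dot a a) ^ 2 := by gcongr
    _ = _ := Real.sq_sqrt (dot_self_nonneg a)
lemma sqDist_eq (a b : Fin m → ℝ) : sqDist a b = dot (a - b) (a - b) := by
  simp [sqDist, dot, sq]
lemma continuous_dot : Continuous fun q : (Fin m → ℝ) × (Fin m → ℝ) => dot q.1 q.2 := by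
  unfold dot; fun_prop

lemma isOpen_M (hF : IsMeanValueExpFam ν M p θ φ ψ carrier) : IsOpen M := by
  obtain ⟨S, hS, rfl⟩ := hF.M_prod
  exact isOpen_set_pi finite_univ fun j _ => (hS j).1

lemma convex_M (hF : IsMeanValueExpFam ν M p θ φ ψ carrier) : Convex ℝ M := by
  obtain ⟨S, hS, rfl⟩ := hF.M_prod
  exact convex_pi fun j _ => (hS j).2.convex

lemma p_pos (hF : IsMeanValueExpFam ν M p θ φ ψ carrier) {μ : Fin m → ℝ} (hμ : μ ∈ M) (x : 𝒳) :
    0 < p μ x := by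
  rw [hF.p_form μ hμ]
  exact mul_pos (Real.exp_pos _) (hF.carrier_pos x)

lemma int_p (hF : IsMeanValueExpFam ν M p θ φ ψ carrier) {μ : Fin m → ℝ} (hμ : μ ∈ M) :
    Integrable (p μ) ν := by
  by_contra h
  have := hF.p_prob μ hμ
  rw [integral_undef h] at this
  norm_num at this

lemma int_φ (hF : IsMeanValueExpFam ν M p θ φ ψ carrier) {μ : Fin m → ℝ} (hμ : μ ∈ M)
    (i : Fin m) : Integrable (fun x => φ x i * p μ x) ν := by
  have hm := hF.φ_meas
  have hm' := hF.p_meas μ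
  refine (hF.φ_int μ hμ).mono' (by fun_prop) (Filter.Eventually.of_forall fun x => ?_)
  rw [Real.norm_eq_abs, abs_mul, abs_of_pos (p_pos hF hμ x)]
  have := (p_pos hF hμ x).le
  gcongr
  exact Finset.single_le_sum (f := fun i => |φ x i|) (fun i _ => abs_nonneg _) (Finset.mem_univ i)

lemma int_dot (hF : IsMeanValueExpFam ν M p θ φ ψ carrier) {μ : Fin m → ℝ} (hμ : μ ∈ M)
    (c : Fin m → ℝ) (k : ℝ) : Integrable (fun x => (dot c (φ x) - k) * p μ x) ν ∧
      ∫ x, (dot c (φ x) - k) * p μ x ∂ν = dot c μ - k := by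
  have e : (fun x => (dot c (φ x) - k) * p μ x)
      = fun x => (∑ i, c i * (φ x i * p μ x)) - k * p μ x := by
    ext x; simp only [dot, sub_mul, Finset.sum_mul, mul_assoc]
  have i1 : ∀ i ∈ Finset.univ, Integrable (fun x => c i * (φ x i * p μ x)) ν :=
    fun i _ => (int_φ hF hμ i).const_mul _
  have i2 : Integrable (fun x => k * p μ x) ν := (int_p hF hμ).const_mul _
  rw [e]
  refine ⟨(integrable_finsetSum _ i1).sub i2, ?_⟩
  rw [integral_sub (integrable_finsetSum _ i1) i2, integral_finsetSum _ i1, integral_const_mul,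
    hF.p_prob μ hμ]
  simp only [integral_const_mul, hF.mean_eq μ hμ, dot, mul_one]

lemma p_ratio (hF : IsMeanValueExpFam ν M p θ φ ψ carrier) {μ μ' : Fin m → ℝ} (hμ : μ ∈ M)
    (hμ' : μ' ∈ M) (x : 𝒳) :
    p μ' x = p μ x * Real.exp (dot (θ μ' - θ μ) (φ x) - (ψ (θ μ') - ψ (θ μ))) := by
  rw [hF.p_form μ hμ, hF.p_form μ' hμ', mul_right_comm, ← Real.exp_add, dot_sub_left]
  ring_nf

lemma log_ratio (hF : IsMeanValueExpFam ν M p θ φ ψ carrier) {μ μ' : Fin m → ℝ} (hμ : μ ∈ M)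
    (hμ' : μ' ∈ M) (x : 𝒳) :
    Real.log (p μ' x / p μ x) = dot (θ μ' - θ μ) (φ x) - (ψ (θ μ') - ψ (θ μ)) := by
  rw [p_ratio hF hμ hμ' x, mul_div_cancel_left₀ _ (p_pos hF hμ x).ne', Real.log_exp]

lemma kl_eq (hF : IsMeanValueExpFam ν M p θ φ ψ carrier) {μ μ' : Fin m → ℝ} (hμ : μ ∈ M)
    (hμ' : μ' ∈ M) :
    klDiv' ν (p μ') (p μ) = dot (θ μ' - θ μ) μ' - (ψ (θ μ') - ψ (θ μ)) := by
  rw [← (int_dot hF hμ' (θ μ' - θ μ) (ψ (θ μ') - ψ (θ μ))).2]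
  unfold klDiv'
  refine integral_congr_ae (Filter.Eventually.of_forall fun x => ?_)
  simp only [log_ratio hF hμ hμ' x]
  ring

lemma kl_nonneg (hF : IsMeanValueExpFam ν M p θ φ ψ carrier) {μ μ' : Fin m → ℝ} (hμ : μ ∈ M)
    (hμ' : μ' ∈ M) : 0 ≤ dot (θ μ' - θ μ) μ' - (ψ (θ μ') - ψ (θ μ)) := by
  have h := int_dot hF hμ' (θ μ' - θ μ) (ψ (θ μ') - ψ (θ μ))
  rw [← h.2]
  have h0 : ∫ x, (p μ' x - p μ x) ∂ν = 0 := by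
    rw [integral_sub (int_p hF hμ') (int_p hF hμ), hF.p_prob _ hμ, hF.p_prob _ hμ', sub_self]
  rw [← h0]
  refine integral_mono ((int_p hF hμ').sub (int_p hF hμ)) h.1 fun x => ?_
  have e := p_ratio hF hμ' hμ x
  have e2 : dot (θ μ - θ μ') (φ x) - (ψ (θ μ) - ψ (θ μ')) =
     -(dot (θ μ' - θ μ) (φ x) - (ψ (θ μ') - ψ (θ μ))) := by
    simp only [dot_sub_left]; ring
  rw [e2] at e
  simp only
  rw [e]
  set L := dot (θ μ' - θ μ) (φ x) - (ψ (θ μ') - ψ (θ μ))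
  have := Real.add_one_le_exp (-L)
  have := p_pos hF hμ' x
  nlinarith

/-- integrability of the square root of the product -/
lemma int_sqrt (hF : IsMeanValueExpFam ν M p θ φ ψ carrier) {μ μ' : Fin m → ℝ} (hμ : μ ∈ M)
    (hμ' : μ' ∈ M) : Integrable (fun x => √(p μ' x * p μ x)) ν := by
  have h1 := hF.p_meas μ
  have h2 := hF.p_meas μ'
  refine ((int_p hF hμ').add (int_p hF hμ)).mono' (by fun_prop)
    (Filter.Eventually.of_forall fun x => ?_)
  rw [Real.norm_eq_abs, abs_of_nonneg (Real.sqrt_nonneg _)]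
  have a := p_pos hF hμ x
  have b := p_pos hF hμ' x
  simp only [Pi.add_apply]
  refine Real.sqrt_le_iff.2 ⟨by positivity, by nlinarith⟩

lemma affinity_ge (hF : IsMeanValueExpFam ν M p θ φ ψ carrier) {μ μ' : Fin m → ℝ} (hμ : μ ∈ M)
    (hμ' : μ' ∈ M) :
    Real.exp (-(klDiv' ν (p μ') (p μ)) / 2) ≤ hellingerAffinity ν (p μ') (p μ) := by
  rw [kl_eq hF hμ hμ']
  set D := dot (θ μ' - θ μ) μ' - (ψ (θ μ') - ψ (θ μ)) with hD
  set w := θ μ' - θ μ with hw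
  set k := ψ (θ μ') - ψ (θ μ) with hk
  have h := int_dot hF hμ' w k
  have hp := int_p hF hμ'
  have e : Real.exp (-D/2) = ∫ x, Real.exp (-D/2) *
      ((1 + D/2) * p μ' x - (1/2) * ((dot w (φ x) - k) * p μ' x)) ∂ν := by
    rw [integral_const_mul, integral_sub (hp.const_mul _) (h.1.const_mul _), integral_const_mul,
      integral_const_mul, h.2, hF.p_prob _ hμ', ← hD]
    ring
  rw [e]
  unfold hellingerAffinity
  refine integral_mono (((hp.const_mul _).sub (h.1.const_mul _)).const_mul _)
    (int_sqrt hF hμ hμ') fun x => ?_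
  have e2 : p μ x = p μ' x * Real.exp (-(dot w (φ x) - k)) := by
    rw [p_ratio hF hμ' hμ x]
    congr 2
    simp only [hw, hk, dot_sub_left]; ring
  have e3 : √(p μ' x * p μ x) = p μ' x * Real.exp (-(dot w (φ x) - k)/2) := by
    rw [e2]
    have := p_pos hF hμ' x
    rw [show p μ' x * (p μ' x * Real.exp (-(dot w (φ x) - k)))
      = (p μ' x * Real.exp (-(dot w (φ x) - k)/2))^2 by
        rw [mul_pow, ← Real.exp_nat_mul]; push_cast; ring_nf]
    exact Real.sqrt_sq (by positivity)
  simp only [e3]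
  have b := p_pos hF hμ' x
  have e4 : Real.exp (-(dot w (φ x) - k)/2) = Real.exp (-D/2) *
      Real.exp (D/2 - (dot w (φ x) - k)/2) := by
    rw [← Real.exp_add]; ring_nf
  rw [e4]
  have := Real.add_one_le_exp (D/2 - (dot w (φ x) - k)/2)
  have h5 : (D/2 - (dot w (φ x) - k)/2 + 1) * p μ' x ≤
    Real.exp (D/2 - (dot w (φ x) - k)/2) * p μ' x := by gcongr
  have h6 := mul_le_mul_of_nonneg_left h5 (Real.exp_pos (-D/2)).le
  linarith

lemma dH2_eq (hF : IsMeanValueExpFam ν M p θ φ ψ carrier) {μ μ' : Fin m → ℝ} (hμ : μ ∈ M)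
    (hμ' : μ' ∈ M) : Integrable (fun x => (√(p μ' x) - √(p μ x))^2) ν ∧
    dH2 ν (p μ') (p μ) = ∫ x, (√(p μ' x) - √(p μ x))^2 ∂ν := by
  have e : (fun x => (√(p μ' x) - √(p μ x))^2) =
      fun x => (p μ' x + p μ x) - 2 * √(p μ' x * p μ x) := by
    ext x
    have a := (p_pos hF hμ x).le
    have b := (p_pos hF hμ' x).le
    rw [Real.sqrt_mul b]
    nlinarith [Real.sq_sqrt a, Real.sq_sqrt b]
  rw [e]
  have i1 := (int_p hF hμ').add (int_p hF hμ)
  have i2 := (int_sqrt hF hμ hμ').const_mul 2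
  refine ⟨i1.sub i2, ?_⟩
  have e3 := integral_sub i1 i2
  simp only [Pi.add_apply] at e3
  rw [e3, integral_const_mul, integral_add (int_p hF hμ') (int_p hF hμ), hF.p_prob _ hμ,
    hF.p_prob _ hμ']
  unfold dH2 hellingerAffinity
  ring

lemma theta_bdd (hF : IsMeanValueExpFam ν M p θ φ ψ carrier) {K : Set (Fin m → ℝ)}
    (hK : IsCompact K) (hKM : K ⊆ M) :
    ∃ R > (0:ℝ), ∀ μ ∈ K, ‖θ μ‖ ≤ R ∧ |ψ (θ μ)| ≤ R := by
  set f : (Fin m → ℝ) → ℝ := fun μ => dot (θ μ) μ - ψ (θ μ) with hf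
  have sub : ∀ μ ∈ M, ∀ μ' ∈ M, f μ + dot (θ μ) (μ' - μ) ≤ f μ' := by
    intro μ hμ μ' hμ'
    have := kl_nonneg hF hμ hμ'
    simp only [hf, dot_sub_left, dot_sub_right] at this ⊢
    linarith
  have hconv : ConvexOn ℝ M f := by
    refine ⟨convex_M hF, fun x hx y hy a b ha hb hab => ?_⟩
    have hz := convex_M hF hx hy ha hb hab
    have h1 := sub _ hz x hx
    have h2 := sub _ hz y hy
    set z := a • x + b • y with hzd
    have e : a * dot (θ z) (x - z) + b * dot (θ z) (y - z) = 0 := by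
      simp only [dot_sub_right]
      have : dot (θ z) z = a * dot (θ z) x + b * dot (θ z) y := by
        conv_lhs => rw [hzd]
        rw [dot_add_right, dot_smul_right, dot_smul_right]
      have hb' : b = 1 - a := by linarith
      rw [this, hb']; ring
    have h1' := mul_le_mul_of_nonneg_left h1 ha
    have h2' := mul_le_mul_of_nonneg_left h2 hb
    simp only [smul_eq_mul]
    have : f z = a * f z + b * f z := by rw [← add_mul, hab, one_mul]
    linarith
  have hcont : ContinuousOn f M := hconv.continuousOn (isOpen_M hF)
  obtain ⟨δ, hδ, hδM⟩ := hK.exists_cthickening_subset_open (isOpen_M hF) hKM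
  obtain ⟨B, hB⟩ := hK.cthickening (r := δ) |>.exists_bound_of_continuousOn (hcont.mono hδM)
  obtain ⟨Rk, hRk⟩ := hK.isBounded.exists_norm_le
  set R1 := |2 * B / δ| with hR1
  have t1 : ∀ μ ∈ K, ‖θ μ‖ ≤ R1 := by
    intro μ hμ
    refine (pi_norm_le_iff_of_nonneg (abs_nonneg _)).2 fun i => ?_
    have hμB := abs_le.1 (hB μ (Metric.self_subset_cthickening _ hμ))
    have key : ∀ s : ℝ, |s| ≤ δ → s * θ μ i ≤ 2 * B := by
      intro s hs
      have hm : μ + Pi.single i s ∈ Metric.cthickening δ K := by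
        refine Metric.mem_cthickening_of_dist_le _ _ _ _ hμ ?_
        simpa [dist_eq_norm, Pi.norm_single] using hs
      have h1 := sub μ (hKM hμ) _ (hδM hm)
      have h2 := abs_le.1 (hB _ hm)
      have h3 : dot (θ μ) (μ + Pi.single i s - μ) = s * θ μ i := by
        simp [dot_eq, mul_comm]
      rw [h3] at h1
      linarith [h2.2, hμB.1]
    have k1 := key δ (by rw [abs_of_pos hδ])
    have k2 := key (-δ) (by rw [abs_neg, abs_of_pos hδ])
    refine le_trans ?_ (le_abs_self _)
    rw [le_div_iff₀ hδ, Real.norm_eq_abs]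
    rcases abs_cases (θ μ i) with ⟨h, _⟩ | ⟨h, _⟩ <;> rw [h] <;> linarith
  refine ⟨max 1 (max R1 (R1 * (m * |Rk|) + B)), lt_of_lt_of_le one_pos (le_max_left _ _),
    fun μ hμ => ⟨(t1 μ hμ).trans ((le_max_left _ _).trans (le_max_right _ _)), ?_⟩⟩
  refine le_trans ?_ ((le_max_right _ _).trans (le_max_right _ _))
  have e : ψ (θ μ) = dot (θ μ) μ - f μ := by simp [hf]
  rw [e]
  refine (abs_sub _ _).trans (add_le_add ?_ (hB μ (Metric.self_subset_cthickening _ hμ)))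
  refine (abs_dot_le _ _).trans (mul_le_mul (t1 μ hμ) ?_ (Finset.sum_nonneg fun _ _ => abs_nonneg _)
    (abs_nonneg _))
  refine (sum_abs_le μ).trans ?_
  gcongr
  exact (hRk μ hμ).trans (le_abs_self _)

lemma gram_bound {ι : Type*} [Fintype ι] [Nonempty ι] (Φ : ι → 𝒳 → ℝ) (g : 𝒳 → ℝ)
    (hint : ∀ i j, Integrable (fun x => Φ i x * Φ j x * g x) ν) (hg : ∀ x, 0 ≤ g x)
    (hpos : ∀ u : ι → ℝ, (fun x => (∑ i, u i * Φ i x) ^ 2 * g x) =ᵐ[ν] 0 → u = 0) :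
    ∃ l > (0:ℝ), ∀ u : ι → ℝ, Integrable (fun x => (∑ i, u i * Φ i x) ^ 2 * g x) ν ∧
      l * ∑ i, u i ^ 2 ≤ ∫ x, (∑ i, u i * Φ i x) ^ 2 * g x ∂ν := by
  have e : ∀ u : ι → ℝ, (fun x => (∑ i, u i * Φ i x) ^ 2 * g x) =
      fun x => ∑ i, ∑ j, (u i * u j) * (Φ i x * Φ j x * g x) := by
    intro u; ext x
    rw [sq, Finset.sum_mul_sum, Finset.sum_mul]
    refine Finset.sum_congr rfl fun i _ => ?_
    rw [Finset.sum_mul]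
    refine Finset.sum_congr rfl fun j _ => by ring
  have hi : ∀ u : ι → ℝ, Integrable (fun x => (∑ i, u i * Φ i x) ^ 2 * g x) ν := by
    intro u; rw [e]
    exact integrable_finsetSum _ fun i _ => integrable_finsetSum _ fun j _ =>
      (hint i j).const_mul _
  set Q : (ι → ℝ) → ℝ := fun u => ∫ x, (∑ i, u i * Φ i x) ^ 2 * g x ∂ν with hQ
  have hQe : Q = fun u => ∑ i, ∑ j, (u i * u j) * ∫ x, Φ i x * Φ j x * g x ∂ν := by
    ext u
    simp only [hQ]
    rw [e u, integral_finsetSum _ fun i _ => integrable_finsetSum _ fun j _ =>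
      (hint i j).const_mul _]
    refine Finset.sum_congr rfl fun i _ => ?_
    rw [integral_finsetSum _ fun j _ => (hint i j).const_mul _]
    exact Finset.sum_congr rfl fun j _ => integral_const_mul _ _
  have hQc : Continuous Q := by rw [hQe]; fun_prop
  have hQn : ∀ (u : ι → ℝ) (x : 𝒳), 0 ≤ (∑ i, u i * Φ i x) ^ 2 * g x := fun u x => mul_nonneg (sq_nonneg _) (hg x)
  have hQp : ∀ u ∈ Metric.sphere (0 : ι → ℝ) 1, 0 < Q u := by
    intro u hu
    refine lt_of_le_of_ne (integral_nonneg (hQn u)) fun h => ?_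
    have := hpos u ((integral_eq_zero_iff_of_nonneg (hQn u) (hi u)).1 h.symm)
    rw [this] at hu
    simp at hu
  obtain ⟨q, hq, hqm⟩ := (isCompact_sphere (0 : ι → ℝ) 1).exists_forall_le' hQc.continuousOn hQp
  have hc : (0:ℝ) < Fintype.card ι := by exact_mod_cast Fintype.card_pos
  refine ⟨q / Fintype.card ι, div_pos hq hc, fun u => ⟨hi u, ?_⟩⟩
  have h1 : ∑ i, u i ^ 2 ≤ Fintype.card ι * ‖u‖ ^ 2 := by
    have := Finset.sum_le_sum (s := Finset.univ) (f := fun i => u i ^ 2) (g := fun _ => ‖u‖ ^ 2)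
      fun i _ => by
        have := norm_le_pi_norm u i
        rw [← sq_abs]
        exact pow_le_pow_left₀ (abs_nonneg _) this 2
    simpa using this
  have h2 : q * ‖u‖ ^ 2 ≤ Q u := by
    by_cases hu : u = 0
    · subst hu; simp [hQ]
    have hn : 0 < ‖u‖ := norm_pos_iff.2 hu
    have h3 := hqm (‖u‖⁻¹ • u) (by simp [norm_smul, hn.ne'])
    have h4 : Q (‖u‖⁻¹ • u) = (‖u‖⁻¹) ^ 2 * Q u := by
      simp only [hQe, Finset.mul_sum, Pi.smul_apply, smul_eq_mul]
      refine Finset.sum_congr rfl fun i _ => Finset.sum_congr rfl fun j _ => by ring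
    rw [h4, inv_pow, inv_mul_eq_div, le_div_iff₀ (by positivity)] at h3
    exact h3
  calc q / Fintype.card ι * ∑ i, u i ^ 2 ≤ q / Fintype.card ι * (Fintype.card ι * ‖u‖ ^ 2) := by
        have := (div_pos hq hc).le
        gcongr
    _ = q * ‖u‖ ^ 2 := by field_simp
    _ ≤ Q u := h2

lemma ae_const (hF : IsMeanValueExpFam ν M p θ φ ψ carrier) (v : Fin m → ℝ) (k : ℝ)
    (h : ∀ᵐ x ∂ν, dot v (φ x) - k = 0) : v = 0 ∧ k = 0 := by
  have h1 : ∀ μ ∈ M, dot v μ - k = 0 := by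
    intro μ hμ
    rw [← (int_dot hF hμ v k).2]
    refine integral_eq_zero_of_ae ?_
    filter_upwards [h] with x hx
    rw [hx]; simp
  obtain ⟨μ0, h0⟩ := hF.M_conn.nonempty
  have hc : ContinuousAt (fun t : ℝ => μ0 + t • v) 0 := by fun_prop
  have hM : ∀ᶠ t : ℝ in nhds 0, μ0 + t • v ∈ M :=
    hc.eventually_mem ((isOpen_M hF).mem_nhds (by simpa using h0))
  obtain ⟨t, ht, htpos⟩ := ((hM.filter_mono nhdsWithin_le_nhds).and
    (self_mem_nhdsWithin : Ioi (0:ℝ) ∈ nhdsWithin 0 (Ioi 0))).exists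
  have a := h1 _ ht
  have b := h1 _ h0
  rw [dot_add_right, dot_smul_right] at a
  have hv : v = 0 := by
    apply dot_self_eq_zero
    have : t * dot v v = 0 := by linarith
    exact (mul_eq_zero.1 this).resolve_left (ne_of_gt htpos)
  refine ⟨hv, ?_⟩
  subst hv
  simpa [dot] using b

lemma exists_minorant (hF : IsMeanValueExpFam ν M p θ φ ψ carrier) {K : Set (Fin m → ℝ)}
    (hK : IsCompact K) (hKM : K ⊆ M) :
    ∃ g : 𝒳 → ℝ, (∀ x, 0 < g x) ∧ (∀ μ ∈ K, ∀ x, g x ≤ p μ x) ∧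
    ∃ l > (0:ℝ), ∀ (v : Fin m → ℝ) (k : ℝ),
      Integrable (fun x => (dot v (φ x) - k) ^ 2 * g x) ν ∧
      l * dot v v ≤ ∫ x, (dot v (φ x) - k) ^ 2 * g x ∂ν := by
  obtain ⟨μ0, h0⟩ := hF.M_conn.nonempty
  obtain ⟨R, hR, hb⟩ := theta_bdd hF (hK.insert μ0) (insert_subset h0 hKM)
  obtain ⟨hb0, hb0'⟩ := hb μ0 (mem_insert _ _)
  set S : 𝒳 → ℝ := fun x => ∑ j, |φ x j| with hS
  have hSn : ∀ x, 0 ≤ S x := fun x => Finset.sum_nonneg fun _ _ => abs_nonneg _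
  have hmφ := hF.φ_meas
  have hmp := hF.p_meas μ0
  have hmS : Measurable S := by simp only [hS]; fun_prop
  set g : 𝒳 → ℝ := fun x => p μ0 x * Real.exp (-(2 * R + 1) * S x - 2 * R) with hg
  have hgpos : ∀ x, 0 < g x := fun x => mul_pos (p_pos hF h0 x) (Real.exp_pos _)
  have hmg : Measurable g := by simp only [hg]; fun_prop
  refine ⟨g, hgpos, ?_, ?_⟩
  · intro μ hμ x
    rw [p_ratio hF h0 (hKM hμ) x]
    simp only [hg]
    refine mul_le_mul_of_nonneg_left (Real.exp_le_exp.2 ?_) (p_pos hF h0 x).le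
    obtain ⟨hb1, hb1'⟩ := hb μ (mem_insert_of_mem _ hμ)
    have h1 : |dot (θ μ - θ μ0) (φ x)| ≤ 2 * R * S x := by
      refine (abs_dot_le _ _).trans ?_
      have := hSn x
      gcongr
      exact (norm_sub_le _ _).trans (by linarith)
    have := (abs_le.1 h1).1
    have := (abs_le.1 hb0').1
    have := (abs_le.1 hb1').2
    have := hSn x
    linarith
  · set Φ : Option (Fin m) → 𝒳 → ℝ := fun o x => o.elim 1 (fun i => φ x i) with hΦ
    have hΦm : ∀ o, Measurable (Φ o) := by
      rintro (_ | i)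
      · exact measurable_const
      · simp only [hΦ, Option.elim]; fun_prop
    have hΦb : ∀ o x, |Φ o x| ≤ 1 + S x := by
      rintro (_ | i) x
      · simp [hΦ, hSn x]
      · have := Finset.single_le_sum (f := fun i => |φ x i|) (fun i _ => abs_nonneg _)
          (Finset.mem_univ i)
        simp only [hΦ, Option.elim]
        linarith
    have hgb : ∀ x, (1 + S x) ^ 2 * g x ≤ 2 * p μ0 x := by
      intro x
      have hs := hSn x
      have h1 : (1 + S x) ^ 2 ≤ 2 * Real.exp (S x) := by
        have := Real.quadratic_le_exp_of_nonneg hs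
        nlinarith
      have h2 : Real.exp (-(2 * R + 1) * S x - 2 * R) ≤ Real.exp (- S x) := by
        gcongr
        nlinarith
      have h3 : Real.exp (S x) * Real.exp (- S x) = 1 := by rw [← Real.exp_add]; simp
      calc (1 + S x) ^ 2 * g x = p μ0 x * ((1 + S x) ^ 2 *
              Real.exp (-(2 * R + 1) * S x - 2 * R)) := by simp only [hg]; ring
        _ ≤ p μ0 x * ((2 * Real.exp (S x)) * Real.exp (- S x)) := by
            have := (p_pos hF h0 x).le
            gcongr
        _ = 2 * p μ0 x := by rw [mul_assoc 2, h3]; ring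
    have hint : ∀ i j, Integrable (fun x => Φ i x * Φ j x * g x) ν := by
      intro i j
      have h1 := hΦm i
      have h2 := hΦm j
      refine ((int_p hF h0).const_mul 2).mono' (by fun_prop)
        (Filter.Eventually.of_forall fun x => ?_)
      refine le_trans ?_ (hgb x)
      rw [Real.norm_eq_abs, abs_mul, abs_mul, abs_of_pos (hgpos x), sq]
      have := (hgpos x).le
      have := hSn x
      gcongr
      · exact hΦb i x
      · exact hΦb j x
    have hsum : ∀ (u : Option (Fin m) → ℝ) x, ∑ i, u i * Φ i x =
        dot (fun i => u (some i)) (φ x) - (- u none) := by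
      intro u x
      rw [Fintype.sum_option]
      simp [hΦ, dot]
      ring
    obtain ⟨l, hl, hlb⟩ := gram_bound (ν := ν) Φ g hint (fun x => (hgpos x).le) (by
      intro u hu
      have : ∀ᵐ x ∂ν, dot (fun i => u (some i)) (φ x) - (- u none) = 0 := by
        filter_upwards [hu] with x hx
        rw [hsum] at hx
        have := (mul_eq_zero.1 hx).resolve_right (hgpos x).ne'
        exact pow_eq_zero_iff (two_ne_zero) |>.1 this
      obtain ⟨h1, h2⟩ := ae_const hF _ _ this
      ext o
      rcases o with (_ | i)
      · simpa using h2
      · exact congrFun h1 i)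
    refine ⟨l, hl, fun v k => ?_⟩
    have := hlb (fun o => o.elim (-k) v)
    simp only [hsum] at this
    simp only [Option.elim, neg_neg, Fintype.sum_option] at this
    refine ⟨this.1, le_trans ?_ this.2⟩
    gcongr
    have : dot v v = ∑ i, v i ^ 2 := by simp [dot, sq]
    rw [this]
    nlinarith [sq_nonneg k]

lemma sub_log_ge {b g L : ℝ} (h1 : g ≤ b) (h2 : g ≤ b * Real.exp L) (hb : 0 < b) :
    L ^ 2 * g ≤ L * (b * Real.exp L) - L * b := by
  rcases le_total 0 L with h | h
  · have := Real.add_one_le_exp L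
    have e1 : L ^ 2 * g ≤ L ^ 2 * b := by gcongr
    have e2 : (L * b) * (L + 1) ≤ (L * b) * Real.exp L := by gcongr
    nlinarith
  · have := Real.add_one_le_exp (-L)
    have e1 : L ^ 2 * g ≤ L ^ 2 * (b * Real.exp L) := by gcongr
    have e3 : (b * Real.exp L) * Real.exp (-L) = b := by
      rw [mul_assoc, ← Real.exp_add]; simp
    have hp : 0 < b * Real.exp L := by positivity
    have e2 : (-L * (b * Real.exp L)) * (-L + 1) ≤ (-L * (b * Real.exp L)) * Real.exp (-L) := by
      have : 0 ≤ -L * (b * Real.exp L) := mul_nonneg (by linarith) hp.le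
      gcongr
    have e4 : (-L * (b * Real.exp L)) * Real.exp (-L) = -L * b := by rw [mul_assoc, e3]
    nlinarith

lemma theta_mono (hF : IsMeanValueExpFam ν M p θ φ ψ carrier) {K : Set (Fin m → ℝ)}
    (hK : IsCompact K) (hKM : K ⊆ M) :
    ∃ l > (0:ℝ), ∀ μ ∈ K, ∀ μ' ∈ K,
      l * dot (θ μ' - θ μ) (θ μ' - θ μ) ≤ dot (θ μ' - θ μ) (μ' - μ) := by
  obtain ⟨g, hg, hgp, l, hl, hlb⟩ := exists_minorant hF hK hKM
  refine ⟨l, hl, fun μ hμ μ' hμ' => ?_⟩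
  set w := θ μ' - θ μ with hw
  set k := ψ (θ μ') - ψ (θ μ) with hk
  obtain ⟨h1, h2⟩ := hlb w k
  refine h2.trans ?_
  obtain ⟨a1, a2⟩ := int_dot hF (hKM hμ') w k
  obtain ⟨b1, b2⟩ := int_dot hF (hKM hμ) w k
  have e : dot w (μ' - μ) = ∫ x, ((dot w (φ x) - k) * p μ' x - (dot w (φ x) - k) * p μ x) ∂ν := by
    rw [integral_sub a1 b1, a2, b2, dot_sub_right]; ring
  rw [e]
  refine integral_mono h1 (a1.sub b1) fun x => ?_
  have hr := p_ratio hF (hKM hμ) (hKM hμ') x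
  simp only
  rw [hr]
  exact sub_log_ge (hgp μ hμ x) (by rw [← hr]; exact hgp μ' hμ' x) (p_pos hF (hKM hμ) x)

lemma theta_lip (hF : IsMeanValueExpFam ν M p θ φ ψ carrier) {K : Set (Fin m → ℝ)}
    (hK : IsCompact K) (hKM : K ⊆ M) :
    ∃ L > (0:ℝ), ∀ μ ∈ K, ∀ μ' ∈ K,
      dot (θ μ' - θ μ) (θ μ' - θ μ) ≤ L * dot (μ' - μ) (μ' - μ) ∧
      dot (θ μ' - θ μ) (μ' - μ) ≤ L * dot (μ' - μ) (μ' - μ) := by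
  obtain ⟨l, hl, h⟩ := theta_mono hF hK hKM
  refine ⟨1 / l + (1 / l) ^ 2, by positivity, fun μ hμ μ' hμ' => ?_⟩
  have h1 := h μ hμ μ' hμ'
  have h2 := dot_sq_le (θ μ' - θ μ) (μ' - μ)
  set A := dot (θ μ' - θ μ) (θ μ' - θ μ)
  set q := dot (θ μ' - θ μ) (μ' - μ)
  have hA : 0 ≤ A := dot_self_nonneg _
  have hB : 0 ≤ dot (μ' - μ) (μ' - μ) := dot_self_nonneg _
  set B := dot (μ' - μ) (μ' - μ)
  have hq : 0 ≤ q := (by positivity : 0 ≤ l * A).trans h1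
  have hqB : q ≤ 1 / l * B := by
    rw [one_div, inv_mul_eq_div, le_div_iff₀ hl]
    rcases hq.eq_or_lt with h0 | h0
    · rw [← h0]; simpa using hB
    · have : q * (q * l) ≤ q * B := by nlinarith
      exact le_of_mul_le_mul_left this h0
  have hAq : A ≤ 1 / l * q := by
    rw [one_div, inv_mul_eq_div, le_div_iff₀ hl]; linarith
  have hl' : 0 < 1 / l := by positivity
  constructor
  · nlinarith
  · nlinarith [mul_nonneg (sq_nonneg (1/l)) hB]

lemma theta_cont (hF : IsMeanValueExpFam ν M p θ φ ψ carrier) {K : Set (Fin m → ℝ)}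
    (hK : IsCompact K) (hKM : K ⊆ M) : ContinuousOn θ K := by
  obtain ⟨L, hL, h⟩ := theta_lip hF hK hKM
  have : LipschitzOnWith (Real.toNNReal (√(L * m))) θ K := by
    refine LipschitzOnWith.of_dist_le_mul fun μ hμ μ' hμ' => ?_
    rw [Real.coe_toNNReal _ (Real.sqrt_nonneg _), dist_eq_norm, dist_eq_norm]
    have h1 := (h μ' hμ' μ hμ).1
    have h2 := norm_sq_le_dot (θ μ - θ μ')
    have h3 := dot_self_le (μ - μ')
    refine abs_le_of_sq_le_sq' ?_ (by positivity) |>.2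
    rw [mul_pow, Real.sq_sqrt (by positivity)]
    nlinarith
  exact this.continuousOn

lemma theta_strict (hF : IsMeanValueExpFam ν M p θ φ ψ carrier) {μ μ' : Fin m → ℝ} (hμ : μ ∈ M)
    (hμ' : μ' ∈ M) (h : θ μ' = θ μ) : μ' = μ := by
  have : p μ' = p μ := by
    ext x; rw [hF.p_form μ hμ, hF.p_form μ' hμ', h]
  ext i
  rw [← hF.mean_eq μ hμ i, ← hF.mean_eq μ' hμ' i, this]

lemma second_moment (hF : IsMeanValueExpFam ν M p θ φ ψ carrier) {K : Set (Fin m → ℝ)}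
    (hK : IsCompact K) (hKM : K ⊆ M) :
    ∃ C > (0:ℝ), ∀ μ ∈ K, Integrable (fun x => ‖φ x‖ ^ 2 * p μ x) ν ∧
      ∫ x, ‖φ x‖ ^ 2 * p μ x ∂ν ≤ C := by
  obtain ⟨δ, hδ, hδM⟩ := hK.exists_cthickening_subset_open (isOpen_M hF) hKM
  set K1 := Metric.cthickening δ K with hK1
  have hK1c : IsCompact K1 := hK.cthickening
  have hKK1 : K ⊆ K1 := Metric.self_subset_cthickening _
  obtain ⟨R, hR, hb⟩ := theta_bdd hF hK1c hδM
  obtain ⟨l, hl, hmono⟩ := theta_mono hF hK1c hδM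
  have hcont := theta_cont hF hK1c hδM
  set Sp := Metric.sphere (0 : Fin m → ℝ) 1 with hSp
  have hmem : ∀ μ ∈ K, ∀ n ∈ Sp, μ + δ • n ∈ K1 := by
    intro μ hμ n hn
    refine Metric.mem_cthickening_of_dist_le _ _ _ _ hμ ?_
    have hn' : ‖n‖ = 1 := by simpa [hSp] using hn
    simp [dist_eq_norm, norm_smul, hn', abs_of_pos hδ]
  set h : (Fin m → ℝ) × (Fin m → ℝ) → ℝ := fun q => dot q.2 (θ (q.1 + δ • q.2) - θ q.1) with hh
  have hhc : ContinuousOn h (K ×ˢ Sp) := by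
    have c1 : ContinuousOn (fun q : (Fin m → ℝ) × (Fin m → ℝ) => θ (q.1 + δ • q.2)) (K ×ˢ Sp) :=
      hcont.comp (by fun_prop) fun q hq => hmem _ hq.1 _ hq.2
    have c2 : ContinuousOn (fun q : (Fin m → ℝ) × (Fin m → ℝ) => θ q.1) (K ×ˢ Sp) :=
      hcont.comp (by fun_prop) fun q hq => hKK1 hq.1
    exact continuous_dot.comp_continuousOn
      ((continuous_snd.continuousOn (s := K ×ˢ Sp)).prodMk (c1.sub c2))
  have hhp : ∀ q ∈ K ×ˢ Sp, 0 < h q := by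
    rintro ⟨μ, n⟩ ⟨hμ, hn⟩
    have m1 := hmem μ hμ n hn
    have h1 := hmono μ (hKK1 hμ) _ m1
    rw [add_sub_cancel_left, dot_smul_right] at h1
    have hw : θ (μ + δ • n) - θ μ ≠ 0 := by
      intro h0
      have := theta_strict hF (hKM hμ) (hδM m1) (sub_eq_zero.1 h0)
      have h2 : n = 0 := by simpa [hδ.ne'] using this
      rw [h2] at hn
      simp [hSp] at hn
    have h3 : 0 < dot (θ (μ + δ • n) - θ μ) (θ (μ + δ • n) - θ μ) :=
      lt_of_le_of_ne (dot_self_nonneg _) fun h0 => hw (dot_self_eq_zero h0.symm)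
    have h4 := lt_of_lt_of_le (mul_pos hl h3) h1
    simp only [hh]
    rw [dot_comm]
    exact pos_of_mul_pos_right h4 hδ.le
  obtain ⟨r0, hr0, hr0h⟩ := (hK.prod (isCompact_sphere (0 : Fin m → ℝ) 1)).exists_forall_le' hhc hhp
  set η := r0 / (2 * (m * (2 * R) + 1)) with hη
  have hηp : 0 < η := by positivity
  obtain ⟨t, htS, htf, htc⟩ := (isCompact_sphere (0 : Fin m → ℝ) 1).finite_cover_balls hηp
  set r := r0 / 2 with hr
  have hrp : 0 < r := by positivity
  set T := htf.toFinset with hT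
  refine ⟨(2 / r ^ 2) * (T.card * Real.exp (2 * R) + 1), by positivity, fun μ hμ => ?_⟩
  have hμM := hKM hμ
  have hTM : ∀ n ∈ T, μ + δ • n ∈ M := fun n hn =>
    hδM (hmem μ hμ n (htS (htf.mem_toFinset.1 hn)))
  set F : 𝒳 → ℝ := fun x => (2 / r ^ 2) * ((∑ n ∈ T, Real.exp (2 * R) * p (μ + δ • n) x) + p μ x)
    with hFd
  have iT : ∀ n ∈ T, Integrable (fun x => Real.exp (2 * R) * p (μ + δ • n) x) ν :=
    fun n hn => (int_p hF (hTM n hn)).const_mul _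
  have iF : Integrable F ν :=
    ((integrable_finsetSum _ iT).add (int_p hF hμM)).const_mul _
  have key : ∀ x, ‖φ x‖ ^ 2 * p μ x ≤ F x := by
    intro x
    have hp := p_pos hF hμM x
    have hs : ∀ n ∈ T, 0 ≤ Real.exp (2 * R) * p (μ + δ • n) x := fun n hn =>
      mul_nonneg (Real.exp_pos _).le (p_pos hF (hTM n hn) x).le
    by_cases hx : φ x = 0
    · have : 0 ≤ F x := by
        have := Finset.sum_nonneg hs
        simp only [hFd]; positivity
      simpa [hx] using this
    have hxp : 0 < ‖φ x‖ := norm_pos_iff.2 hx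
    have hn1 : ‖φ x‖⁻¹ • φ x ∈ Sp := by simp [hSp, norm_smul, hxp.ne']
    set n := ‖φ x‖⁻¹ • φ x with hn
    obtain ⟨n', hn't, hn'd⟩ := by simpa using htc hn1
    have hn'S : n' ∈ Sp := htS hn't
    have hn'T : n' ∈ T := htf.mem_toFinset.2 hn't
    have e1 : φ x = ‖φ x‖ • n := by rw [hn, smul_smul, mul_inv_cancel₀ hxp.ne', one_smul]
    have h1 : r0 ≤ dot n' (θ (μ + δ • n') - θ μ) := hr0h (μ, n') ⟨hμ, hn'S⟩
    obtain ⟨b1, b1'⟩ := hb μ (hKK1 hμ)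
    obtain ⟨b2, b2'⟩ := hb _ (hmem μ hμ n' hn'S)
    set w := θ (μ + δ • n') - θ μ with hw
    have hwR : ‖w‖ ≤ 2 * R := (norm_sub_le _ _).trans (by linarith)
    have h2 : |dot (n - n') w| ≤ r := by
      refine (abs_dot_le _ _).trans ?_
      rw [dist_eq_norm] at hn'd
      calc ‖n - n'‖ * ∑ j, |w j| ≤ η * (m * (2 * R)) := by
            refine mul_le_mul hn'd.le ((sum_abs_le w).trans ?_)
              (Finset.sum_nonneg fun _ _ => abs_nonneg _) hηp.le
            gcongr
        _ ≤ η * (m * (2 * R) + 1) := by gcongr; linarith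
        _ = r := by rw [hη, hr]; field_simp
    have h3 : r ≤ dot n w := by
      rw [dot_sub_left] at h2
      have := (abs_le.1 h2).1
      linarith
    have h4 : r * ‖φ x‖ ≤ dot w (φ x) := by
      rw [dot_comm, e1, dot_comm, dot_smul_right, dot_comm, ← e1]
      nlinarith
    have h5 : p μ x * Real.exp (r * ‖φ x‖) ≤ Real.exp (2 * R) * p (μ + δ • n') x := by
      rw [p_ratio hF hμM (hTM n' hn'T) x, mul_left_comm, ← Real.exp_add]
      refine mul_le_mul_of_nonneg_left (Real.exp_le_exp.2 ?_) hp.le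
      have := (abs_le.1 b1').1
      have := (abs_le.1 b2').2
      linarith
    have h6 := Finset.single_le_sum hs hn'T
    have h7 : ‖φ x‖ ^ 2 ≤ 2 / r ^ 2 * Real.exp (r * ‖φ x‖) := by
      have := Real.quadratic_le_exp_of_nonneg (x := r * ‖φ x‖) (by positivity)
      rw [div_mul_eq_mul_div, le_div_iff₀ (by positivity)]
      nlinarith [mul_pos hrp hxp]
    calc ‖φ x‖ ^ 2 * p μ x ≤ 2 / r ^ 2 * Real.exp (r * ‖φ x‖) * p μ x := by gcongr
      _ = 2 / r ^ 2 * (p μ x * Real.exp (r * ‖φ x‖)) := by ring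
      _ ≤ F x := by
        simp only [hFd]
        gcongr
        linarith
  have hmφ := hF.φ_meas
  have hmp := hF.p_meas μ
  have i0 : Integrable (fun x => ‖φ x‖ ^ 2 * p μ x) ν := by
    refine iF.mono' ?_ (Filter.Eventually.of_forall fun x => ?_)
    · exact ((hmφ.norm.pow_const 2).mul hmp).aestronglyMeasurable
    · rw [Real.norm_eq_abs, abs_of_nonneg]
      · exact key x
      · exact mul_nonneg (sq_nonneg _) (p_pos hF hμM x).le
  refine ⟨i0, (integral_mono i0 iF key).trans (le_of_eq ?_)⟩
  simp only [hFd]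
  rw [integral_const_mul, integral_add (integrable_finsetSum _ iT) (int_p hF hμM),
    integral_finsetSum _ iT, hF.p_prob μ hμM]
  congr 2
  rw [Finset.sum_congr rfl fun n hn => by rw [integral_const_mul, hF.p_prob _ (hTM n hn)]]
  simp

lemma second_moment_dot (hF : IsMeanValueExpFam ν M p θ φ ψ carrier) {μ : Fin m → ℝ} {C : ℝ}
    (hμ : μ ∈ M) (h1 : Integrable (fun x => ‖φ x‖ ^ 2 * p μ x) ν)
    (h2 : ∫ x, ‖φ x‖ ^ 2 * p μ x ∂ν ≤ C) (v : Fin m → ℝ) :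
    Integrable (fun x => dot v (φ x) ^ 2 * p μ x) ν ∧
    ∫ x, dot v (φ x) ^ 2 * p μ x ∂ν ≤ (m * C) * dot v v := by
  have hmφ := hF.φ_meas
  have hmp := hF.p_meas μ
  have hv := dot_self_nonneg v
  have hmd : Measurable fun x => dot v (φ x) := by unfold dot; fun_prop
  have key : ∀ x, dot v (φ x) ^ 2 * p μ x ≤ (m * dot v v) * (‖φ x‖ ^ 2 * p μ x) := by
    intro x
    have := (p_pos hF hμ x).le
    calc dot v (φ x) ^ 2 * p μ x ≤ (dot v v * (m * ‖φ x‖ ^ 2)) * p μ x := by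
          gcongr
          exact (dot_sq_le _ _).trans (mul_le_mul_of_nonneg_left (dot_self_le _) hv)
      _ = _ := by ring
  have i0 : Integrable (fun x => dot v (φ x) ^ 2 * p μ x) ν := by
    refine (h1.const_mul (m * dot v v)).mono' (by fun_prop)
      (Filter.Eventually.of_forall fun x => ?_)
    rw [Real.norm_eq_abs, abs_of_nonneg]
    · exact key x
    · exact mul_nonneg (sq_nonneg _) (p_pos hF hμ x).le
  refine ⟨i0, (integral_mono i0 (h1.const_mul _) key).trans ?_⟩
  rw [integral_const_mul]
  calc m * dot v v * ∫ x, ‖φ x‖ ^ 2 * p μ x ∂ν ≤ m * dot v v * C := by gcongr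
    _ = _ := by ring

lemma hellinger_lower (hF : IsMeanValueExpFam ν M p θ φ ψ carrier) {μ μ' : Fin m → ℝ} {C : ℝ}
    (hμ : μ ∈ M) (hμ' : μ' ∈ M) (hC : 0 < C)
    (h1 : ∀ v, Integrable (fun x => dot v (φ x) ^ 2 * p μ x) ν ∧
      ∫ x, dot v (φ x) ^ 2 * p μ x ∂ν ≤ C * dot v v)
    (h2 : ∀ v, Integrable (fun x => dot v (φ x) ^ 2 * p μ' x) ν ∧
      ∫ x, dot v (φ x) ^ 2 * p μ' x ∂ν ≤ C * dot v v) :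
    1 / (4 * C) * dot (μ' - μ) (μ' - μ) ≤ dH2 ν (p μ') (p μ) := by
  obtain ⟨i0, e0⟩ := dH2_eq hF hμ hμ'
  set d := μ' - μ with hd
  obtain ⟨a1, a2⟩ := int_dot hF hμ' d 0
  obtain ⟨b1, b2⟩ := int_dot hF hμ d 0
  simp only [sub_zero] at a1 a2 b1 b2
  have e : dot d d = ∫ x, (dot d (φ x) * p μ' x - dot d (φ x) * p μ x) ∂ν := by
    rw [integral_sub a1 b1, a2, b2, ← dot_sub_right]
  set G : 𝒳 → ℝ := fun x => (2 * C) * (√(p μ' x) - √(p μ x)) ^ 2 +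
    (1 / (4 * C)) * (dot d (φ x) ^ 2 * p μ' x + dot d (φ x) ^ 2 * p μ x) with hG
  have iG1 := i0.const_mul (2 * C)
  have iG2 := (((h2 d).1.add (h1 d).1)).const_mul (1 / (4 * C))
  have iG : Integrable G ν := iG1.add iG2
  have h3 : dot d d ≤ ∫ x, G x ∂ν := by
    rw [e]
    refine integral_mono (a1.sub b1) iG fun x => ?_
    simp only [hG]
    set s := √(p μ' x) with hs
    set s' := √(p μ x) with hs'
    have q1 : p μ' x = s ^ 2 := (Real.sq_sqrt (p_pos hF hμ' x).le).symm
    have q2 : p μ x = s' ^ 2 := (Real.sq_sqrt (p_pos hF hμ x).le).symm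
    rw [q1, q2]
    set D := dot d (φ x)
    have t1 : (D * (s + s')) ^ 2 ≤ 2 * (D ^ 2 * s ^ 2 + D ^ 2 * s' ^ 2) := by
      nlinarith [sq_nonneg (D * (s - s'))]
    have t2 : D * s ^ 2 - D * s' ^ 2 = (s - s') * (D * (s + s')) := by ring
    rw [t2]
    set Y := D * (s + s')
    set X := s - s'
    have t3 : X * Y ≤ 2 * C * X ^ 2 + 1 / (4 * C) * (Y ^ 2 / 2) := by
      have : 2 * C * X ^ 2 + 1 / (4 * C) * (Y ^ 2 / 2) - X * Y = (4 * C * X - Y) ^ 2 / (8 * C) := by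
        field_simp; ring
      have : 0 ≤ (4 * C * X - Y) ^ 2 / (8 * C) := by positivity
      linarith
    refine t3.trans ?_
    gcongr
    linarith
  have h4 : ∫ x, G x ∂ν ≤ 2 * C * dH2 ν (p μ') (p μ) + 1 / 2 * dot d d := by
    simp only [hG]
    have e5 := integral_add iG1 iG2
    simp only [Pi.add_apply] at e5
    rw [e5, integral_const_mul, integral_const_mul, integral_add (h2 d).1 (h1 d).1, ← e0]
    have := (h1 d).2
    have := (h2 d).2
    have : 1 / (4 * C) * (∫ x, dot d (φ x) ^ 2 * p μ' x ∂ν + ∫ x, dot d (φ x) ^ 2 * p μ x ∂ν)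
      ≤ 1 / (4 * C) * (C * dot d d + C * dot d d) := by gcongr
    have e6 : 1 / (4 * C) * (C * dot d d + C * dot d d) = 1 / 2 * dot d d := by field_simp; ring
    linarith
  rw [one_div, inv_mul_eq_div, div_le_iff₀ (by positivity)]
  linarith

lemma quadForm_eq (J : Matrix (Fin m) (Fin m) ℝ) (v : Fin m → ℝ) :
    quadForm J v = dot v (J.mulVec v) := by
  simp only [quadForm, dot, Matrix.mulVec, dotProduct, Finset.mul_sum, mul_assoc]

lemma inv_quad {A : Matrix (Fin m) (Fin m) ℝ} (hs : A.transpose = A) {l C : ℝ} (hl : 0 < l)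
    (hC : 0 < C) (h : ∀ v, l * dot v v ≤ quadForm A v ∧ quadForm A v ≤ C * dot v v)
    (u : Fin m → ℝ) :
    1 / C * dot u u ≤ quadForm A⁻¹ u ∧ quadForm A⁻¹ u ≤ 1 / l * dot u u := by
  have hinj : Function.Injective A.mulVec := by
    intro a b hab
    have hz : A.mulVec (a - b) = 0 := by rw [Matrix.mulVec_sub, hab, sub_self]
    have h1 := (h (a - b)).1
    rw [quadForm_eq, hz] at h1
    have h2 : dot (a - b) 0 = 0 := by simp [dot]
    rw [h2] at h1
    have h3 := dot_self_nonneg (a - b)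
    have h4 : dot (a - b) (a - b) = 0 := by nlinarith
    exact sub_eq_zero.1 (dot_self_eq_zero h4)
  have hu : IsUnit A := Matrix.mulVec_injective_iff_isUnit.1 hinj
  have hdet : IsUnit A.det := (Matrix.isUnit_iff_isUnit_det A).1 hu
  set w := A⁻¹.mulVec u with hw
  have hAw : A.mulVec w = u := by
    rw [hw, Matrix.mulVec_mulVec, Matrix.mul_nonsing_inv _ hdet, Matrix.one_mulVec]
  have hq : quadForm A⁻¹ u = dot u w := by rw [quadForm_eq]
  have hq2 : quadForm A w = dot u w := by rw [quadForm_eq, hAw, dot_comm]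
  rw [hq]
  have hw1 := (h w).1
  rw [hq2] at hw1
  have hww := dot_self_nonneg w
  have huu := dot_self_nonneg u
  have hq0 : 0 ≤ dot u w := (by positivity : 0 ≤ l * dot w w).trans hw1
  constructor
  · have hsym : dot w (A.mulVec u) = dot u u := by
      rw [dot_eq, Matrix.dotProduct_mulVec, ← Matrix.mulVec_transpose, hs, hAw, dot_eq]
    have hz := (h (w - (1 / C) • u)).1
    have hz' := (mul_nonneg hl.le (dot_self_nonneg (w - (1 / C) • u))).trans hz
    have e : quadForm A (w - (1 / C) • u) =
        dot u w - 2 * (1 / C) * dot u u + (1 / C) ^ 2 * quadForm A u := by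
      rw [quadForm_eq, quadForm_eq, Matrix.mulVec_sub, Matrix.mulVec_smul, hAw]
      simp only [dot_sub_right, dot_sub_left, dot_smul_right]
      rw [dot_comm ((1 / C) • u) u, dot_comm ((1 / C) • u) (A.mulVec u), dot_smul_right,
        dot_smul_right, hsym, dot_comm w u, dot_comm (A.mulVec u) u]
      ring
    have h5 : (1 / C) ^ 2 * quadForm A u ≤ (1 / C) * dot u u := by
      calc (1 / C) ^ 2 * quadForm A u ≤ (1 / C) ^ 2 * (C * dot u u) := by
            gcongr; exact (h u).2
        _ = _ := by field_simp
    linarith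
  · rw [one_div, inv_mul_eq_div, le_div_iff₀ hl]
    have hcs := dot_sq_le u w
    rcases hq0.eq_or_lt with h0 | h0
    · rw [← h0]; simpa using huu
    · have : dot u w * (dot u w * l) ≤ dot u w * dot u u := by nlinarith
      exact le_of_mul_le_mul_left this h0

lemma cov_quad (hF : IsMeanValueExpFam ν M p θ φ ψ carrier) {μ : Fin m → ℝ}
    (hμ : μ ∈ M) (h1 : Integrable (fun x => ‖φ x‖ ^ 2 * p μ x) ν) (v : Fin m → ℝ) :
    quadForm (covMatrix ν p φ μ) v = ∫ x, (dot v (φ x) - dot v μ) ^ 2 * p μ x ∂ν := by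
  have hmφ := hF.φ_meas
  have hmp := hF.p_meas μ
  have hi : ∀ i j, Integrable (fun x => (φ x i - μ i) * (φ x j - μ j) * p μ x) ν := by
    intro i j
    refine ((h1.const_mul 2).add ((int_p hF hμ).const_mul (2 * ‖μ‖ ^ 2))).mono' (by fun_prop)
      (Filter.Eventually.of_forall fun x => ?_)
    have hp := (p_pos hF hμ x).le
    rw [Real.norm_eq_abs, abs_mul, abs_mul, abs_of_nonneg hp]
    have hk : ∀ i, |φ x i - μ i| ≤ ‖φ x‖ + ‖μ‖ := fun i =>
      (abs_sub _ _).trans (add_le_add (norm_le_pi_norm (φ x) i) (norm_le_pi_norm μ i))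
    simp only [Pi.add_apply]
    calc |φ x i - μ i| * |φ x j - μ j| * p μ x ≤ (‖φ x‖ + ‖μ‖) * (‖φ x‖ + ‖μ‖) * p μ x := by
          gcongr
          · exact hk i
          · exact hk j
      _ ≤ (2 * ‖φ x‖ ^ 2 + 2 * ‖μ‖ ^ 2) * p μ x := by
          gcongr
          nlinarith [sq_nonneg (‖φ x‖ - ‖μ‖)]
      _ = _ := by ring
  have e : (fun x => (dot v (φ x) - dot v μ) ^ 2 * p μ x) =
      fun x => ∑ i, ∑ j, (v i * v j) * ((φ x i - μ i) * (φ x j - μ j) * p μ x) := by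
    ext x
    rw [← dot_sub_right, sq]
    unfold dot
    rw [Finset.sum_mul_sum, Finset.sum_mul]
    refine Finset.sum_congr rfl fun i _ => ?_
    rw [Finset.sum_mul]
    refine Finset.sum_congr rfl fun j _ => by simp only [Pi.sub_apply]; ring
  rw [e, integral_finsetSum _ fun i _ => integrable_finsetSum _ fun j _ => (hi i j).const_mul _]
  unfold quadForm covMatrix
  refine Finset.sum_congr rfl fun i _ => ?_
  rw [integral_finsetSum _ fun j _ => (hi i j).const_mul _]
  refine Finset.sum_congr rfl fun j _ => ?_
  rw [integral_const_mul, Matrix.of_apply]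
  ring

lemma cov_bounds (hF : IsMeanValueExpFam ν M p θ φ ψ carrier) {μ : Fin m → ℝ} {C l : ℝ}
    {g : 𝒳 → ℝ} (hμ : μ ∈ M) (h1 : Integrable (fun x => ‖φ x‖ ^ 2 * p μ x) ν)
    (h2 : ∀ v, Integrable (fun x => dot v (φ x) ^ 2 * p μ x) ν ∧
      ∫ x, dot v (φ x) ^ 2 * p μ x ∂ν ≤ C * dot v v)
    (hg : ∀ x, g x ≤ p μ x)
    (hlb : ∀ (v : Fin m → ℝ) (k : ℝ),
      Integrable (fun x => (dot v (φ x) - k) ^ 2 * g x) ν ∧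
      l * dot v v ≤ ∫ x, (dot v (φ x) - k) ^ 2 * g x ∂ν) (v : Fin m → ℝ) :
    l * dot v v ≤ quadForm (covMatrix ν p φ μ) v ∧
    quadForm (covMatrix ν p φ μ) v ≤ C * dot v v := by
  rw [cov_quad hF hμ h1]
  obtain ⟨a1, a2⟩ := int_dot hF hμ v 0
  simp only [sub_zero] at a1 a2
  have e : (fun x => (dot v (φ x) - dot v μ) ^ 2 * p μ x) = fun x =>
      (dot v (φ x) ^ 2 * p μ x - (2 * dot v μ) * (dot v (φ x) * p μ x)) +
        (dot v μ) ^ 2 * p μ x := by ext x; ring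
  have j1 := (h2 v).1
  have j2 := a1.const_mul (2 * dot v μ)
  have j3 := (int_p hF hμ).const_mul ((dot v μ) ^ 2)
  have i0 : Integrable (fun x => (dot v (φ x) - dot v μ) ^ 2 * p μ x) ν := by
    rw [e]; exact (j1.sub j2).add j3
  constructor
  · refine (hlb v (dot v μ)).2.trans (integral_mono (hlb v (dot v μ)).1 i0 fun x => ?_)
    simp only
    gcongr
    exact hg x
  · rw [e]
    have e1 := integral_add (j1.sub j2) j3
    have e2 := integral_sub j1 j2
    simp only [Pi.sub_apply] at e1
    rw [e1, e2, integral_const_mul, integral_const_mul, a2, hF.p_prob μ hμ]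
    have := (h2 v).2
    nlinarith [sq_nonneg (dot v μ)]

lemma cov_symm (μ : Fin m → ℝ) : (covMatrix ν p φ μ).transpose = covMatrix ν p φ μ := by
  ext i j
  simp only [covMatrix, Matrix.transpose_apply, Matrix.of_apply]
  congr 1
  ext x
  ring

end helpers

end SwitchPaper

namespace SwitchPaper

/-- Proposition 1, first part: on a CINECSI subset `M'` of the mean-value
parameter space `M` of an exponential family, the squared error, standardized squared error,
squared Hellinger, Rényi(1/2) and KL divergences are all equivalent up to constants:
`c₁‖μ'−μ‖₂² ≤ c₂·d_ST(μ'‖μ) ≤ d_{H²}(μ',μ) ≤ d_R(μ',μ) ≤ D(μ'‖μ) ≤ c₃‖μ'−μ‖₂²`. -/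
theorem statement_0 {𝒳 : Type*} [MeasurableSpace 𝒳] {m : ℕ} (ν : Measure 𝒳)
    (M M' : Set (Fin m → ℝ)) (p : (Fin m → ℝ) → 𝒳 → ℝ)
    (θ : (Fin m → ℝ) → (Fin m → ℝ)) (φ : 𝒳 → (Fin m → ℝ)) (ψ : (Fin m → ℝ) → ℝ)
    (carrier : 𝒳 → ℝ)
    (hF : IsMeanValueExpFam ν M p θ φ ψ carrier)
    (hM' : CINECSI M' M) :
    ∃ c₁ > (0:ℝ), ∃ c₂ > (0:ℝ), ∃ c₃ > (0:ℝ), ∀ μ ∈ M', ∀ μ' ∈ M',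
      c₁ * sqDist μ' μ ≤ c₂ * dST ν p φ μ' μ ∧
      c₂ * dST ν p φ μ' μ ≤ dH2 ν (p μ') (p μ) ∧
      dH2 ν (p μ') (p μ) ≤ dRenyiHalf ν (p μ') (p μ) ∧
      dRenyiHalf ν (p μ') (p μ) ≤ klDiv' ν (p μ') (p μ) ∧
      klDiv' ν (p μ') (p μ) ≤ c₃ * sqDist μ' μ := by
  obtain ⟨-, hsub, hcpt, -⟩ := hM'
  have hKM : M' ⊆ M := hsub.trans interior_subset
  obtain ⟨g, hg, hgp, l, hl, hlb⟩ := exists_minorant hF hcpt hKM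
  obtain ⟨C₀, hC₀, hsm⟩ := second_moment hF hcpt hKM
  obtain ⟨L, hL, hlip⟩ := theta_lip hF hcpt hKM
  set C : ℝ := m * C₀ + 1 with hCd
  have hC : 0 < C := by positivity
  have hmom : ∀ μ ∈ M', ∀ v, Integrable (fun x => dot v (φ x) ^ 2 * p μ x) ν ∧
      ∫ x, dot v (φ x) ^ 2 * p μ x ∂ν ≤ C * dot v v := by
    intro μ hμ v
    obtain ⟨s1, s2⟩ := second_moment_dot hF (hKM hμ) (hsm μ hμ).1 (hsm μ hμ).2 v
    refine ⟨s1, s2.trans ?_⟩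
    have := dot_self_nonneg v
    gcongr
    linarith
  have hc2 : 0 < l / (4 * C) := by positivity
  refine ⟨l / (4 * C) * (1 / C), by positivity, l / (4 * C), hc2, L, hL, fun μ hμ μ' hμ' => ?_⟩
  have hμM := hKM hμ
  have hμM' := hKM hμ'
  have hinv := inv_quad (cov_symm (ν := ν) (p := p) (φ := φ) μ') hl hC
    (cov_bounds hF hμM' (hsm μ' hμ').1 (hmom μ' hμ') (hgp μ' hμ') hlb) (μ - μ')
  have hsq : sqDist μ' μ = dot (μ - μ') (μ - μ') := by
    simp only [sqDist, dot, Pi.sub_apply]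
    exact Finset.sum_congr rfl fun i _ => by ring
  have haff := affinity_ge hF hμM hμM'
  have hA : 0 < hellingerAffinity ν (p μ') (p μ) := lt_of_lt_of_le (Real.exp_pos _) haff
  refine ⟨?_, ?_, ?_, ?_, ?_⟩
  · rw [hsq, mul_assoc]
    exact mul_le_mul_of_nonneg_left hinv.1 hc2.le
  · have h1 := hellinger_lower hF hμM hμM' hC (hmom μ hμ) (hmom μ' hμ')
    rw [← sqDist_eq, hsq] at h1
    refine le_trans (mul_le_mul_of_nonneg_left hinv.2 hc2.le) (le_trans (le_of_eq ?_) h1)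
    field_simp
  · unfold dH2 dRenyiHalf
    have := Real.log_le_sub_one_of_pos hA
    linarith
  · unfold dRenyiHalf
    have := (Real.le_log_iff_exp_le hA).2 haff
    linarith
  · rw [sqDist_eq]
    refine le_trans ?_ (hlip μ hμ μ' hμ').2
    rw [kl_eq hF hμM hμM']
    have := kl_nonneg hF hμM' hμM
    simp only [dot_sub_left, dot_sub_right] at this ⊢
    linarith

end SwitchPaper
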